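/- arXiv:1202.2451 — 11 statements merged into one kernel-verified Lean document; each statement's English description precedes it below -/
import Mathlib

section
/- Let K be a field, A a subring of K, and let Y be a nonempty subset of Zar(K|A). For every ultrafilter 𝒰 on Y, the set A_𝒰 := {x ∈ K : B_x ∩ Y ∈ 𝒰} is a valuation subring of K (a valuation domain with quotient field K) containing A. -/
open TopologicalSpace

variable {K : Type*} [Field K]

/-- `Zar A` is the Zariski–Riemann space `Zar(K|A)`: the valuation subrings of `K` containing `A`. -/
abbrev Zar (A : Subring K) : Type _ := {V : ValuationSubring K // A ≤ V.toSubring}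

/-- `bo A S` is the set `B_S = {V ∈ Zar(K|A) : S ⊆ V}`. -/
def bo (A : Subring K) (S : Set K) : Set (Zar A) := {V | S ⊆ (V.1 : Set K)}

/-- For an ultrafilter `U` on a subset `Y` of `Zar(K|A)`, the set
`A_U = {x ∈ K : B_x ∩ Y ∈ U}`. -/
def ultraSet (A : Subring K) {Y : Set (Zar A)} (U : Ultrafilter Y) : Set K :=
  {x | {V : Y | x ∈ V.1.1} ∈ U}

/-- A subset `Y` of `Zar(K|A)` is stable for ultrafilters if `A_U ∈ Y` for every
ultrafilter `U` on `Y`. -/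
def UltraStable (A : Subring K) (Y : Set (Zar A)) : Prop :=
  ∀ (U : Ultrafilter Y) (W : Zar A), (W.1 : Set K) = ultraSet A U → W ∈ Y

/-- The Zariski topology on `Zar(K|A)`, with the sets `B_F` (`F ⊆ K` finite) as a basis. -/
def zarTop (A : Subring K) : TopologicalSpace (Zar A) :=
  generateFrom {S | ∃ F : Finset K, S = bo A ↑F}

/-- The `#`-topology on `Zar(K|A)`: the coarsest topology in which every `B_F`
(`F ⊆ K` finite) is both open and closed. -/
def sharpTop (A : Subring K) : TopologicalSpace (Zar A) :=
  generateFrom ({S | ∃ F : Finset K, S = bo A ↑F} ∪ {S | ∃ F : Finset K, S = (bo A ↑F)ᶜ})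

/-- The Boolean algebra of sets generated by a family `G` of subsets of `X`. -/
inductive BoolGen {X : Type*} (G : Set (Set X)) : Set X → Prop
  | base (s : Set X) (hs : s ∈ G) : BoolGen G s
  | compl (s : Set X) (hs : BoolGen G s) : BoolGen G sᶜ
  | union (s t : Set X) (hs : BoolGen G s) (ht : BoolGen G t) : BoolGen G (s ∪ t)
  | inter (s t : Set X) (hs : BoolGen G s) (ht : BoolGen G t) : BoolGen G (s ∩ t)

/-- The constructible topology associated with a topology `t` on `X`: the topology having as a
basis of open sets the Boolean algebra generated by the quasi-compact open subsets of `(X, t)`. -/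
def consTop {X : Type*} (t : TopologicalSpace X) : TopologicalSpace X :=
  generateFrom {s | BoolGen {U : Set X | t.IsOpen U ∧ @IsCompact X t U} s}

/-- The center map `γ : Zar(K|A) → Spec(A)` sending `V` to `M_V ∩ A`. -/
noncomputable def centerMap (A : Subring K) (V : Zar A) : PrimeSpectrum ↥A :=
  ⟨(IsLocalRing.maximalIdeal ↥V.1).comap (Subring.inclusion V.2), inferInstance⟩

/-- `x` belongs to the maximal ideal `M_V` of the valuation subring `V`. -/
def inMax (V : ValuationSubring K) (x : K) : Prop :=
  ∃ h : x ∈ V, (⟨x, h⟩ : ↥V) ∈ IsLocalRing.maximalIdeal ↥V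

/-- The constructible (patch) topology on `Spec R`: the coarsest topology in which every basic
open set `D_a = {P : a ∉ P}` is both open and closed. -/
def patchTop (R : Type*) [CommRing R] : TopologicalSpace (PrimeSpectrum R) :=
  generateFrom ({S | ∃ a : R, S = {P : PrimeSpectrum R | a ∉ P.asIdeal}} ∪
    {S | ∃ a : R, S = {P : PrimeSpectrum R | a ∉ P.asIdeal}ᶜ})

/-- The ultrafilter limit point set `P_U = {a ∈ R : V(a) ∩ C ∈ U}`. -/
def specLimitSet {R : Type*} [CommRing R] {C : Set (PrimeSpectrum R)} (U : Ultrafilter C) :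
    Set R :=
  {a | {P : C | a ∈ P.1.asIdeal} ∈ U}

/-- A subset `C ⊆ Spec R` is ultrafilter closed if it contains all of its ultrafilter limit
points. -/
def SpecStable {R : Type*} [CommRing R] (C : Set (PrimeSpectrum R)) : Prop :=
  ∀ (U : Ultrafilter C) (P : PrimeSpectrum R), (P.asIdeal : Set R) = specLimitSet U → P ∈ C

/-- Let `K` be a field, `A` a subring of `K`, and `Y` a nonempty subset of
`Zar(K|A)`. For every ultrafilter `U` on `Y`, the set `A_U = {x ∈ K : B_x ∩ Y ∈ U}` is a
valuation subring of `K` containing `A`. -/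
theorem statement0 {K : Type*} [Field K] (A : Subring K) (Y : Set (Zar A)) (hY : Y.Nonempty)
    (U : Ultrafilter Y) :
    ∃ W : ValuationSubring K, A ≤ W.toSubring ∧ (W : Set K) = ultraSet A U := by
  refine ⟨{ carrier := ultraSet A U
            mul_mem' := fun {a b} ha hb => ?_
            one_mem' := ?_
            add_mem' := fun {a b} ha hb => ?_
            zero_mem' := ?_
            neg_mem' := fun {a} ha => ?_
            mem_or_inv_mem' := fun a => ?_ }, fun a ha => ?_, rfl⟩
  · exact Filter.mem_of_superset (Filter.inter_mem ha hb) fun V h => V.1.1.mul_mem _ _ h.1 h.2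
  · exact Filter.Eventually.of_forall fun V => V.1.1.one_mem
  · exact Filter.mem_of_superset (Filter.inter_mem ha hb) fun V h => V.1.1.add_mem _ _ h.1 h.2
  · exact Filter.Eventually.of_forall fun V => V.1.1.zero_mem
  · exact Filter.mem_of_superset ha fun V h => V.1.1.neg_mem _ h
  · exact Ultrafilter.eventually_or.mp (.of_forall fun V : Y => V.1.1.mem_or_inv_mem a)
  · exact Filter.Eventually.of_forall fun V : Y => V.1.2 ha
end

section
/- Let K be a field and A a subring of K. If 𝒞 is any collection of subsets of Zar(K|A) each of which is stable for ultrafilters, then the intersection ⋂𝒞 is stable for ultrafilters. Consequently, the subsets of Zar(K|A) stable for ultrafilters are the closed sets of a topology on Zar(K|A) (the ultrafilter topology). -/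
open TopologicalSpace

variable {K : Type*} [Field K]

/-- Stability for ultrafilters, phrased with ultrafilters on the whole space containing `Y`. -/
lemma ultraStable_iff {K : Type*} [Field K] (A : Subring K) (Y : Set (Zar A)) :
    UltraStable A Y ↔ ∀ (F : Ultrafilter (Zar A)) (W : Zar A), Y ∈ F →
      (W.1 : Set K) = {x | {V : Zar A | x ∈ V.1} ∈ F} → W ∈ Y := by
  constructor
  · intro h F W hY hW
    have hr : Set.range (Subtype.val : Y → Zar A) ∈ F := by rwa [Subtype.range_coe]
    refine h (F.comap Subtype.val_injective hr) W (hW.trans ?_)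
    have hmap : (F.comap Subtype.val_injective hr).map Subtype.val = F := by
      apply Ultrafilter.coe_injective
      rw [Ultrafilter.coe_map, Ultrafilter.coe_comap, Filter.map_comap_of_mem hr]
    conv_lhs => rw [← hmap]
    rfl
  · intro h U W hW
    refine h (U.map Subtype.val) W ?_ hW
    exact Ultrafilter.mem_map.2 (Filter.mem_of_superset Filter.univ_mem fun V _ => V.2)

lemma UltraStable.sInter {K : Type*} [Field K] {A : Subring K} {𝒞 : Set (Set (Zar A))}
    (h𝒞 : ∀ C ∈ 𝒞, UltraStable A C) : UltraStable A (⋂₀ 𝒞) := by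
  refine (ultraStable_iff A _).2 fun F W hF hW C hC => ?_
  exact (ultraStable_iff A C).1 (h𝒞 C hC) F W
    (Filter.mem_of_superset hF (Set.sInter_subset_of_mem hC)) hW

lemma UltraStable.union {K : Type*} [Field K] {A : Subring K} {Y Z : Set (Zar A)}
    (hY : UltraStable A Y) (hZ : UltraStable A Z) : UltraStable A (Y ∪ Z) := by
  refine (ultraStable_iff A _).2 fun F W hF hW => ?_
  rcases Ultrafilter.union_mem_iff.1 hF with h | h
  · exact Or.inl ((ultraStable_iff A Y).1 hY F W h hW)
  · exact Or.inr ((ultraStable_iff A Z).1 hZ F W h hW)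

lemma ultraStable_empty {K : Type*} [Field K] (A : Subring K) : UltraStable A ∅ :=
  (ultraStable_iff A ∅).2 fun F _ hF _ => (F.empty_notMem hF).elim

/-- Any intersection of subsets of `Zar(K|A)` stable for ultrafilters is stable
for ultrafilters; consequently, the subsets stable for ultrafilters are the closed sets of a
topology (the ultrafilter topology) on `Zar(K|A)`. -/
theorem statement2 {K : Type*} [Field K] (A : Subring K) :
    (∀ 𝒞 : Set (Set (Zar A)), (∀ C ∈ 𝒞, UltraStable A C) → UltraStable A (⋂₀ 𝒞)) ∧
      ∃ t : TopologicalSpace (Zar A), ∀ C : Set (Zar A), @IsClosed _ t C ↔ UltraStable A C := by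
  refine ⟨fun _ h => UltraStable.sInter h, ?_⟩
  refine ⟨.ofClosed {C | UltraStable A C} (ultraStable_empty A) (fun _ h => UltraStable.sInter h)
    (fun _ hY _ hZ => UltraStable.union hY hZ), fun C => ?_⟩
  rw [← @isOpen_compl_iff]
  change UltraStable A Cᶜᶜ ↔ _
  rw [compl_compl]
end

section
/- Let K be a field and A a subring of K. For every finite subset F of K, the set Zar(K|A) \ B_F is stable for ultrafilters. Consequently, the ultrafilter topology on Zar(K|A) is finer than the Zariski topology. -/
open TopologicalSpace

variable {K : Type*} [Field K]

/-- For every finite subset `F` of `K`, the complement of `B_F` is stable for ultrafilters. -/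
theorem ultraStable_compl_bo {K : Type*} [Field K] (A : Subring K) (F : Finset K) :
    UltraStable A ((bo A ↑F)ᶜ) := by
  intro U W hW hF
  have hmem : {V : ↥(bo A (F : Set K))ᶜ | ∀ x ∈ F, x ∈ V.1.1} ∈ U := by
    refine (Filter.eventually_all_finset F).2 fun x hx => ?_
    have hx' : x ∈ (W.1 : Set K) := hF hx
    rw [hW] at hx'
    exact hx'
  obtain ⟨V, hV⟩ := U.nonempty_of_mem hmem
  exact V.2 fun x hx => hV x hx

/-- For every finite subset `F` of `K`, the set `Zar(K|A) \ B_F` is stable for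
ultrafilters; consequently, the ultrafilter topology on `Zar(K|A)` is finer than the Zariski
topology. -/
theorem statement3 {K : Type*} [Field K] (A : Subring K)
    (t : TopologicalSpace (Zar A)) (ht : ∀ C : Set (Zar A), @IsClosed _ t C ↔ UltraStable A C) :
    (∀ F : Finset K, UltraStable A ((bo A ↑F)ᶜ)) ∧ t ≤ zarTop A := by
  refine ⟨ultraStable_compl_bo A, le_generateFrom ?_⟩
  rintro _ ⟨F, rfl⟩
  exact (@isClosed_compl_iff _ t _).1 ((ht _).2 (ultraStable_compl_bo A F))
end

section
/- Let K be a field and A a subring of K. The ultrafilter topology on Zar(K|A) coincides with the #-topology, i.e., with the coarsest topology in which B_F is both open and closed for every finite subset F of K. -/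
open TopologicalSpace

variable {K : Type*} [Field K]

theorem ultrafilter_le_nhds_sharpTop_iff {K : Type*} [Field K] (A : Subring K)
    (u : Ultrafilter (Zar A)) (W : Zar A) :
    (u : Filter (Zar A)) ≤ @nhds _ (sharpTop A) W ↔
      ∀ x : K, x ∈ W.1 ↔ {V : Zar A | x ∈ V.1} ∈ u := by
  have bo_singleton (x : K) : bo A ↑({x} : Finset K) = {V : Zar A | x ∈ V.1} := by
    ext V; simp [bo]
  rw [sharpTop, nhds_generateFrom]
  simp only [le_iInf_iff, Filter.le_principal_iff, Set.mem_ofPred_eq, Ultrafilter.mem_coe]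
  constructor
  · intro h x
    constructor
    · intro hx
      exact h _ ⟨hx, Or.inl ⟨{x}, (bo_singleton x).symm⟩⟩
    · intro hx
      by_contra hW
      exact Ultrafilter.compl_mem_iff_notMem.mp
        (h {V : Zar A | x ∈ V.1}ᶜ ⟨hW, Or.inr ⟨{x}, by rw [bo_singleton]⟩⟩) hx
  · intro h
    have bo_mem (F : Finset K) : bo A ↑F ∈ u ↔ W ∈ bo A ↑F := by
      have : bo A ↑F = ⋂ x ∈ F, {V : Zar A | x ∈ V.1} := by
        ext V; simp [bo, Set.subset_def]
      rw [this, ← Ultrafilter.mem_coe, Filter.biInter_finset_mem]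
      simp [h]
    rintro s ⟨hW, ⟨F, rfl⟩ | ⟨F, rfl⟩⟩
    · exact (bo_mem F).mpr hW
    · exact Ultrafilter.compl_mem_iff_notMem.mpr fun hF => hW ((bo_mem F).mp hF)

theorem ultraStable_iff_isClosed_sharpTop {K : Type*} [Field K] (A : Subring K)
    (C : Set (Zar A)) : UltraStable A C ↔ @IsClosed _ (sharpTop A) C := by
  let := sharpTop A
  rw [isClosed_iff_ultrafilter]
  constructor
  · intro h W u hu hC
    have hr : Set.range ((↑) : C → Zar A) ∈ u := by rwa [Subtype.range_coe]
    refine h (u.comap Subtype.val_injective hr) W (Set.ext fun x => ?_)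
    have hmap : (u.comap Subtype.val_injective hr).map ((↑) : C → Zar A) = u :=
      Ultrafilter.coe_injective (Filter.map_comap_of_mem hr)
    refine ((ultrafilter_le_nhds_sharpTop_iff A u W).mp hu x).trans ?_
    conv_lhs => rw [← hmap]
    exact Iff.rfl
  · intro h U W hW
    refine h W (U.map Subtype.val) ?_ (Ultrafilter.mem_map.mpr (Filter.univ_mem' fun V => V.2))
    exact (ultrafilter_le_nhds_sharpTop_iff A _ W).mpr fun x => Set.ext_iff.mp hW x

/-- The ultrafilter topology on `Zar(K|A)` coincides with the `#`-topology,
i.e. with the coarsest topology in which every `B_F` (`F ⊆ K` finite) is both open and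
closed. -/
theorem statement8 {K : Type*} [Field K] (A : Subring K)
    (t : TopologicalSpace (Zar A)) (ht : ∀ C : Set (Zar A), @IsClosed _ t C ↔ UltraStable A C) :
    t = sharpTop A :=
  TopologicalSpace.ext_iff_isClosed.mpr fun C =>
    (ht C).trans (ultraStable_iff_isClosed_sharpTop A C)
end

section
/- Let K be a field and A a subring of K. The space Zar(K|A) endowed with the Zariski topology is a quasi-compact Kolmogoroff (T0) topological space. -/
open TopologicalSpace

variable {K : Type*} [Field K]

/-- The limit of an ultrafilter `U` on `Zar(K|A)`: the valuation subring of all `x ∈ K` that lie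
in `U`-almost every `V`. -/
def ultraLim (A : Subring K) (U : Ultrafilter (Zar A)) : Zar A where
  val :=
    { carrier := {x | ∀ᶠ V : Zar A in U, x ∈ V.1}
      mul_mem' := fun hx hy => by
        filter_upwards [hx, hy] with V hx hy using mul_mem hx hy
      one_mem' := Filter.Eventually.of_forall fun V => one_mem V.1
      add_mem' := fun hx hy => by
        filter_upwards [hx, hy] with V hx hy using add_mem hx hy
      zero_mem' := Filter.Eventually.of_forall fun V => zero_mem V.1
      neg_mem' := fun hx => by
        filter_upwards [hx] with V hx using neg_mem hx
      mem_or_inv_mem' := fun x =>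
        Ultrafilter.eventually_or.mp
          (Filter.Eventually.of_forall fun V : Zar A => V.1.mem_or_inv_mem x) }
  property := fun _ hx => Filter.Eventually.of_forall fun V : Zar A => V.2 hx

theorem mem_ultraLim {A : Subring K} {U : Ultrafilter (Zar A)} {x : K} :
    x ∈ (ultraLim A U).1 ↔ ∀ᶠ V : Zar A in U, x ∈ V.1 :=
  Iff.rfl

theorem le_nhds_ultraLim (A : Subring K) (U : Ultrafilter (Zar A)) :
    (U : Filter (Zar A)) ≤ @nhds _ (zarTop A) (ultraLim A U) := by
  rw [zarTop, nhds_generateFrom]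
  refine le_iInf₂ ?_
  rintro _ ⟨hmem, F, rfl⟩
  rw [Filter.le_principal_iff]
  exact F.eventually_all.mpr fun x hx => mem_ultraLim.mp (hmem hx)

theorem compactSpace_zarTop (A : Subring K) : @CompactSpace (Zar A) (zarTop A) := by
  let _ := zarTop A
  exact ⟨isCompact_iff_ultrafilter_le_nhds.mpr fun U _ =>
    ⟨ultraLim A U, Set.mem_univ _, le_nhds_ultraLim A U⟩⟩

theorem isOpen_setOf_mem (A : Subring K) (x : K) :
    @IsOpen _ (zarTop A) {V : Zar A | x ∈ V.1} :=
  isOpen_generateFrom_of_mem ⟨{x}, by ext V; simp [bo]⟩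

theorem t0Space_zarTop (A : Subring K) : @T0Space (Zar A) (zarTop A) := by
  let _ := zarTop A
  refine ⟨fun V W h => Subtype.ext (SetLike.ext fun x => ?_)⟩
  exact h.mem_open_iff (isOpen_setOf_mem A x)

/-- `Zar(K|A)` with the Zariski topology is a quasi-compact Kolmogoroff (T0)
topological space. -/
theorem statement10 {K : Type*} [Field K] (A : Subring K) :
    @CompactSpace (Zar A) (zarTop A) ∧ @T0Space (Zar A) (zarTop A) := by
  exact ⟨compactSpace_zarTop A, t0Space_zarTop A⟩
end

section
/- Let K be a field, A a subring of K, and Y a subset of Zar(K|A). The closure of Y in the ultrafilter topology on Zar(K|A) equals the set {A_𝒰 : 𝒰 an ultrafilter on Y}. -/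
open TopologicalSpace

variable {K : Type*} [Field K]

/-- The set `A_U` is unchanged when `U` is pushed forward along an inclusion `Y ⊆ C`. -/
theorem ultraSet_map_inclusion (A : Subring K) {Y C : Set (Zar A)} (h : Y ⊆ C)
    (U : Ultrafilter Y) : ultraSet A (U.map (Set.inclusion h)) = ultraSet A U :=
  rfl

theorem ultraSet_pure (A : Subring K) {Y : Set (Zar A)} (V : Y) :
    ultraSet A (pure V : Ultrafilter Y) = (V.1.1 : Set K) :=
  rfl

/-- An ultrafilter limit of ultrafilter limits of `Y` is an ultrafilter limit of `Y`. -/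
theorem ultraStable_setOf_ultraSet (A : Subring K) (Y : Set (Zar A)) :
    UltraStable A {V : Zar A | ∃ U : Ultrafilter Y, (V.1 : Set K) = ultraSet A U} := by
  intro W V hV
  choose f hf using fun S : {V : Zar A | ∃ U : Ultrafilter Y, (V.1 : Set K) = ultraSet A U} => S.2
  refine ⟨W.bind f, hV.trans (Set.ext fun x => ?_)⟩
  have key : {S : {V : Zar A | ∃ U : Ultrafilter Y, (V.1 : Set K) = ultraSet A U} | x ∈ S.1.1} =
      {S | {V : Y | x ∈ V.1.1} ∈ f S} :=
    Set.ext fun S => Set.ext_iff.mp (hf S) x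
  change _ ∈ W ↔ {S | {V : Y | x ∈ V.1.1} ∈ f S} ∈ W
  rw [key]

/-- For any subset `Y` of `Zar(K|A)`, the closure of `Y` in the ultrafilter
topology equals `{A_U : U an ultrafilter on Y}`. -/
theorem statement11 {K : Type*} [Field K] (A : Subring K)
    (t : TopologicalSpace (Zar A)) (ht : ∀ C : Set (Zar A), @IsClosed _ t C ↔ UltraStable A C)
    (Y : Set (Zar A)) :
    @closure _ t Y = {V : Zar A | ∃ U : Ultrafilter Y, (V.1 : Set K) = ultraSet A U} := by
  apply Set.Subset.antisymm
  · exact closure_minimal (fun V hV => ⟨pure ⟨V, hV⟩, (ultraSet_pure A ⟨V, hV⟩).symm⟩)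
      ((ht _).mpr (ultraStable_setOf_ultraSet A Y))
  · rintro V ⟨U, hU⟩
    exact (ht _).mp (@isClosed_closure _ t Y) (U.map (Set.inclusion (@subset_closure _ t Y))) V
      (hU.trans (ultraSet_map_inclusion A _ U).symm)
end

section
/- Let K be a field and A a subring of K. The center map γ : Zar(K|A) → Spec(A), sending a valuation subring V with maximal ideal M_V to the prime ideal M_V ∩ A of A, is continuous when Zar(K|A) carries the ultrafilter topology and Spec(A) carries the constructible (patch) topology. -/
open TopologicalSpace

variable {K : Type*} [Field K]

theorem ultraStable_setOf_mem (A : Subring K) (x : K) : UltraStable A {V : Zar A | x ∈ V.1} := by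
  intro U W hW
  have h : x ∈ ultraSet A U := Filter.mem_of_superset Filter.univ_mem fun V _ => V.2
  rwa [← hW] at h

theorem ultraStable_setOf_notMem (A : Subring K) (x : K) :
    UltraStable A {V : Zar A | x ∉ V.1} := by
  intro U W hW hx
  have h : x ∈ ultraSet A U := hW ▸ hx
  obtain ⟨V, hV⟩ := U.nonempty_of_mem h
  exact V.2 hV

theorem notMem_centerMap_iff (A : Subring K) (V : Zar A) (a : A) :
    a ∉ (centerMap A V).asIdeal ↔ (a : K) ≠ 0 ∧ (a : K)⁻¹ ∈ V.1 := by
  change (⟨a, V.2 a.2⟩ : V.1) ∉ IsLocalRing.maximalIdeal V.1 ↔ _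
  rw [IsLocalRing.mem_maximalIdeal, mem_nonunits_iff, not_not]
  constructor
  · intro h
    obtain ⟨b, hb⟩ := h.exists_right_inv
    have hab : (a : K) * (b : K) = 1 := congrArg Subtype.val hb
    exact ⟨left_ne_zero_of_mul_eq_one hab, inv_eq_of_mul_eq_one_right hab ▸ b.2⟩
  · rintro ⟨h0, h⟩
    exact IsUnit.of_mul_eq_one ⟨(a : K)⁻¹, h⟩ (Subtype.ext (mul_inv_cancel₀ h0))

/-- The center map `γ : Zar(K|A) → Spec(A)` is continuous when `Zar(K|A)`
carries the ultrafilter topology and `Spec(A)` carries the constructible (patch) topology. -/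
theorem statement12 {K : Type*} [Field K] (A : Subring K)
    (t : TopologicalSpace (Zar A)) (ht : ∀ C : Set (Zar A), @IsClosed _ t C ↔ UltraStable A C) :
    @Continuous _ _ t (patchTop ↥A) (centerMap A) := by
  have key (a : A) : IsClopen (centerMap A ⁻¹' {P | a ∉ P.asIdeal}) := by
    simp only [Set.preimage_ofPred_eq, notMem_centerMap_iff]
    by_cases ha : (a : K) = 0
    · simp [ha, isClopen_empty]
    · simp only [ne_eq, ha, not_false_eq_true, true_and]
      refine ⟨(ht _).2 (ultraStable_setOf_mem A _), ?_⟩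
      exact isClosed_compl_iff.1 ((ht _).2 (ultraStable_setOf_notMem A _))
  refine continuous_generateFrom_iff.2 ?_
  rintro _ (⟨a, rfl⟩ | ⟨a, rfl⟩)
  · exact (key a).isOpen
  · exact (key a).compl.isOpen
end

section
/- Let K be a field and A a subring of K. The center map γ : Zar(K|A) → Spec(A), sending a valuation subring V with maximal ideal M_V to M_V ∩ A, is a closed map when Zar(K|A) carries the ultrafilter topology and Spec(A) carries the constructible (patch) topology. -/
open TopologicalSpace

variable {K : Type*} [Field K]

/-- The set `ultraSet A U` attached to an ultrafilter `U` is a valuation ring containing `A`. -/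
def ultraLimit (A : Subring K) {Y : Set (Zar A)} (U : Ultrafilter Y) :
    Zar A where
  val :=
    { carrier := ultraSet A U
      mul_mem' := fun ha hb => Filter.mem_of_superset (Filter.inter_mem ha hb)
        fun V hV => V.1.1.mul_mem _ _ hV.1 hV.2
      one_mem' := Filter.mem_of_superset Filter.univ_mem fun V _ => V.1.1.one_mem
      add_mem' := fun ha hb => Filter.mem_of_superset (Filter.inter_mem ha hb)
        fun V hV => V.1.1.add_mem _ _ hV.1 hV.2
      zero_mem' := Filter.mem_of_superset Filter.univ_mem fun V _ => V.1.1.zero_mem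
      neg_mem' := fun ha => Filter.mem_of_superset ha fun V hV => V.1.1.neg_mem _ hV
      mem_or_inv_mem' := fun x => Ultrafilter.union_mem_iff.1 <|
        Filter.mem_of_superset Filter.univ_mem fun V _ => V.1.1.mem_or_inv_mem x }
  property := fun _ ha => Filter.mem_of_superset Filter.univ_mem fun V _ => V.1.2 ha

lemma mem_ultraLimit {A : Subring K} {Y : Set (Zar A)} (U : Ultrafilter Y)
    (x : K) : x ∈ (ultraLimit A U).1 ↔ {V : Y | x ∈ V.1.1} ∈ U :=
  Iff.rfl

lemma mem_centerMap {A : Subring K} (V : Zar A) (a : A) :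
    a ∈ (centerMap A V).asIdeal ↔ (a : K) = 0 ∨ (a : K)⁻¹ ∉ V.1 := by
  change (⟨a, V.2 a.2⟩ : V.1) ∈ IsLocalRing.maximalIdeal V.1 ↔ _
  rw [ValuationSubring.valuation_lt_one_iff, ← ValuationSubring.valuation_le_one_iff, not_le,
    map_inv₀]
  by_cases h : (a : K) = 0
  · simp [h]
  · simp [h, one_lt_inv₀ (zero_lt_iff.2 ((map_ne_zero V.1.valuation).2 h))]

/-- The limit of an ultrafilter commutes with the center map. -/
lemma mem_centerMap_ultraLimit {A : Subring K} {Y : Set (Zar A)}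
    (U : Ultrafilter Y) (a : A) :
    a ∈ (centerMap A (ultraLimit A U)).asIdeal ↔ {V : Y | a ∈ (centerMap A V.1).asIdeal} ∈ U := by
  simp only [mem_centerMap, mem_ultraLimit]
  by_cases h : (a : K) = 0
  · simp only [h, true_or, Set.ofPred_true, true_iff]
    exact Filter.univ_mem
  · simp only [h, false_or, ← Ultrafilter.compl_mem_iff_notMem, Set.compl_ofPred]

lemma mem_asIdeal_iff_of_le_nhds {R : Type*} [CommRing R] {F : Ultrafilter (PrimeSpectrum R)}
    {P : PrimeSpectrum R} (hF : (F : Filter (PrimeSpectrum R)) ≤ @nhds _ (patchTop R) P) (a : R) :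
    a ∈ P.asIdeal ↔ {Q : PrimeSpectrum R | a ∈ Q.asIdeal} ∈ F := by
  let := patchTop R
  have ho : IsOpen {Q : PrimeSpectrum R | a ∉ Q.asIdeal} :=
    isOpen_generateFrom_of_mem (Or.inl ⟨a, rfl⟩)
  have hc : IsOpen {Q : PrimeSpectrum R | a ∉ Q.asIdeal}ᶜ :=
    isOpen_generateFrom_of_mem (Or.inr ⟨a, rfl⟩)
  constructor
  · intro ha
    simpa [Set.compl_ofPred] using hF (hc.mem_nhds (by simpa using ha))
  · intro ha
    by_contra h
    exact Ultrafilter.compl_mem_iff_notMem.1 (hF (ho.mem_nhds h)) ha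

/-- The center map `γ : Zar(K|A) → Spec(A)` is a closed map when `Zar(K|A)`
carries the ultrafilter topology and `Spec(A)` carries the constructible (patch) topology. -/
theorem statement13 {K : Type*} [Field K] (A : Subring K)
    (t : TopologicalSpace (Zar A)) (ht : ∀ C : Set (Zar A), @IsClosed _ t C ↔ UltraStable A C) :
    @IsClosedMap _ _ t (patchTop ↥A) (centerMap A) := by
  let := patchTop ↥A
  intro C hC
  refine isClosed_iff_ultrafilter.2 fun P F hF hCF => ?_
  have hr : (fun V : C => centerMap A V.1) '' Set.univ ∈ F := by
    rwa [Set.image_univ, ← Set.image_eq_range]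
  let U := Ultrafilter.ofComapInfPrincipal hr
  have hU : U.map (fun V : C => centerMap A V.1) = F :=
    Ultrafilter.ofComapInfPrincipal_eq_of_map hr
  refine ⟨ultraLimit A U, (ht C).1 hC U _ rfl, ?_⟩
  ext a
  rw [mem_centerMap_ultraLimit, mem_asIdeal_iff_of_le_nhds hF, ← hU, Ultrafilter.mem_map]
  rfl
end

section
/- Let K be a field, A a subring of K, Y a subset of Zar(K|A), and 𝒰 an ultrafilter on Y. Then the center of the valuation subring A_𝒰 over A equals the set {a ∈ A : {V ∈ Y : a ∈ M_V} ∈ 𝒰}, where M_V denotes the maximal ideal of V; that is, M_{A_𝒰} ∩ A = {a ∈ A : {V ∈ Y : a ∈ M_V} ∈ 𝒰}. -/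
open TopologicalSpace

variable {K : Type*} [Field K]

/-- `inMax V x` says that `x` is a nonunit of `V`. -/
theorem inMax_iff {K : Type*} [Field K] (V : ValuationSubring K) (x : K) :
    inMax V x ↔ x = 0 ∨ x⁻¹ ∉ V :=
  V.mem_nonunits_iff_exists_mem_maximalIdeal.symm.trans V.mem_nonunits_iff_or

theorem mem_centerMap_iff {K : Type*} [Field K] (A : Subring K) (W : Zar A) (a : A) :
    a ∈ (centerMap A W).asIdeal ↔ inMax W.1 a :=
  ⟨fun h => ⟨W.2 a.2, h⟩, fun ⟨_, h⟩ => h⟩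

/-- For `Y ⊆ Zar(K|A)` and an ultrafilter `U` on `Y`, the center of the
valuation subring `A_U` over `A` equals `{a ∈ A : {V ∈ Y : a ∈ M_V} ∈ U}`. -/
theorem statement14 {K : Type*} [Field K] (A : Subring K) (Y : Set (Zar A)) (U : Ultrafilter Y)
    (W : Zar A) (hW : (W.1 : Set K) = ultraSet A U) :
    ((centerMap A W).asIdeal : Set ↥A) = {a : ↥A | {V : Y | inMax V.1.1 ↑a} ∈ U} := by
  ext a
  have hmem : (a : K)⁻¹ ∈ W.1 ↔ {V : Y | (a : K)⁻¹ ∈ V.1.1} ∈ U := by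
    rw [← SetLike.mem_coe, hW]
    rfl
  rw [SetLike.mem_coe, mem_centerMap_iff, inMax_iff, hmem, ← Ultrafilter.compl_mem_iff_notMem,
    Set.mem_ofPred_eq]
  simp only [inMax_iff]
  by_cases ha : (a : K) = 0
  · simp [ha, ← Ultrafilter.mem_coe]
  · simp [ha, Set.compl_ofPred]
end

section
/- Let R be a commutative ring, C a subset of Spec(R), and 𝒰 an ultrafilter on C. Then the set P_𝒰 := {a ∈ R : {P ∈ C : a ∈ P} ∈ 𝒰} is a prime ideal of R. -/
open TopologicalSpace

variable {K : Type*} [Field K]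

/-- For a commutative ring `R`, a subset `C ⊆ Spec(R)` and an ultrafilter `U`
on `C`, the set `P_U = {a ∈ R : V(a) ∩ C ∈ U}` is a prime ideal of `R`. -/
theorem statement18 {R : Type*} [CommRing R] (C : Set (PrimeSpectrum R)) (U : Ultrafilter C) :
    ∃ I : Ideal R, I.IsPrime ∧ (I : Set R) = specLimitSet U := by
  refine ⟨{ carrier := specLimitSet U, add_mem' := ?_, zero_mem' := ?_, smul_mem' := ?_ }, ?_, rfl⟩
  · intro a b ha hb
    exact Filter.mem_of_superset (Filter.inter_mem ha hb)
      fun P hP => P.1.asIdeal.add_mem hP.1 hP.2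
  · exact Filter.mem_of_superset Filter.univ_mem fun P _ => P.1.asIdeal.zero_mem
  · intro c a ha
    exact Filter.mem_of_superset ha fun P hP => P.1.asIdeal.mul_mem_left c hP
  · refine ⟨(Ideal.ne_top_iff_one _).2 fun h => ?_, fun {a b} hab => ?_⟩
    · obtain ⟨P, hP⟩ := U.nonempty_of_mem h
      exact (Ideal.ne_top_iff_one _).1 P.1.isPrime.ne_top hP
    · exact Ultrafilter.union_mem_iff.1
        (Filter.mem_of_superset hab fun P hP => P.1.isPrime.mem_or_mem hP)
end

section
/- Let R be a commutative ring. The ultrafilter topology on Spec(R), whose closed sets are the subsets C ⊆ Spec(R) containing all their ultrafilter limit points P_𝒰, coincides with the constructible (patch) topology on Spec(R), i.e., with the coarsest topology in which each basic Zariski-open set D_a := {P ∈ Spec(R) : a ∉ P} (a ∈ R) is both open and closed. -/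
open TopologicalSpace

variable {K : Type*} [Field K]

/-- An ultrafilter on `Spec R` converges to `P` in the patch topology exactly when `P` is the set
of those `a` for which the ultrafilter contains `V(a)`. -/
theorem ultrafilter_le_nhds_patchTop_iff {R : Type*} [CommRing R]
    (F : Ultrafilter (PrimeSpectrum R)) (P : PrimeSpectrum R) :
    ↑F ≤ @nhds _ (patchTop R) P ↔
      (P.asIdeal : Set R) = {a | {Q : PrimeSpectrum R | a ∈ Q.asIdeal} ∈ F} := by
  rw [patchTop, nhds_generateFrom]
  simp only [le_iInf_iff, Filter.le_principal_iff]
  constructor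
  · intro h
    ext a
    constructor
    · intro ha
      have := h {Q : PrimeSpectrum R | a ∉ Q.asIdeal}ᶜ ⟨fun hn => hn ha, Or.inr ⟨a, rfl⟩⟩
      simpa [Set.compl_ofPred] using this
    · intro ha
      by_contra hn
      have := h {Q : PrimeSpectrum R | a ∉ Q.asIdeal} ⟨hn, Or.inl ⟨a, rfl⟩⟩
      exact Ultrafilter.compl_notMem_iff.mpr ha this
  · rintro h s ⟨hP, ⟨a, rfl⟩ | ⟨a, rfl⟩⟩
    · have hn : a ∉ (P.asIdeal : Set R) := hP
      rw [h] at hn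
      exact Ultrafilter.compl_mem_iff_notMem.mpr hn
    · have ha : a ∈ (P.asIdeal : Set R) := not_not.mp hP
      rw [h] at ha
      simpa [Set.compl_ofPred] using ha

theorem isClosed_patchTop_iff_specStable {R : Type*} [CommRing R] (C : Set (PrimeSpectrum R)) :
    @IsClosed _ (patchTop R) C ↔ SpecStable C := by
  let := patchTop R
  rw [isClosed_iff_ultrafilter]
  constructor
  · intro h U P hP
    refine h P (U.map Subtype.val) ((ultrafilter_le_nhds_patchTop_iff _ _).mpr hP) ?_
    exact Ultrafilter.mem_map.mpr (Filter.mem_of_superset Filter.univ_mem fun Q _ => Q.2)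
  · intro h P F hF hC
    have hr : Set.range (Subtype.val : C → PrimeSpectrum R) ∈ F := by
      rwa [Subtype.range_coe]
    refine h (F.comap Subtype.val_injective hr) P
      (((ultrafilter_le_nhds_patchTop_iff _ _).mp hF).trans ?_)
    ext a
    have hmap : (F.comap Subtype.val_injective hr).map Subtype.val = F :=
      Ultrafilter.coe_injective (Filter.map_comap_of_mem hr)
    conv_lhs => rw [← hmap]
    rfl

/-- For a commutative ring `R`, the ultrafilter topology on `Spec(R)` (whose
closed sets are the subsets containing all their ultrafilter limit points) coincides with the
constructible (patch) topology on `Spec(R)`. -/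
theorem statement19 {R : Type*} [CommRing R]
    (t : TopologicalSpace (PrimeSpectrum R))
    (ht : ∀ C : Set (PrimeSpectrum R), @IsClosed _ t C ↔ SpecStable C) :
    t = patchTop R := by
  exact TopologicalSpace.ext_isClosed fun C => (ht C).trans (isClosed_patchTop_iff_specStable C).symm
end
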